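/- arXiv:2506.09863 — 4 statements merged into one kernel-verified Lean document; each statement's English description precedes it below -/
import Mathlib

section
/- Let R be the unique positive real with R²√(1+R²) = 1 and λ = 1 + 1/(2√(1+R²)). For all ξ, η ∈ ℝ³, the two conditions Φ_{f+}(ξ,η) = 0 and ∇_η Φ_{f+}(ξ,η) = 0 hold simultaneously if and only if ξ = λ·η and |η| = R. -/
noncomputable section

/-- The phase `Φ_{f+}(ξ,η) = |ξ|² − ⟨η⟩ − |ξ−η|²` with `⟨η⟩ = √(1+|η|²)`. -/
def phiFplus (ξ η : EuclideanSpace ℝ (Fin 3)) : ℝ :=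
  ‖ξ‖ ^ 2 - Real.sqrt (1 + ‖η‖ ^ 2) - ‖ξ - η‖ ^ 2

theorem phiFplus_hasGradientAt (ξ η : EuclideanSpace ℝ (Fin 3)) :
    HasGradientAt (phiFplus ξ)
      ((2:ℝ) • (ξ - η) - (1 / Real.sqrt (1 + ‖η‖ ^ 2)) • η) η := by
  rw [hasGradientAt_iff_hasFDerivAt]
  have hpos : (1 + ‖η‖ ^ 2) ≠ 0 := by positivity
  have h1 := (((hasFDerivAt_id η).norm_sq).const_add 1).sqrt hpos
  have h2 := ((hasFDerivAt_id η).const_sub ξ).norm_sq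
  have h3 := (h1.const_sub (‖ξ‖ ^ 2)).sub h2
  refine h3.congr_fderiv ?_
  ext v
  have hs : Real.sqrt (1 + ‖η‖ ^ 2) ≠ 0 := by positivity
  simp
  field_simp
  ring

/-- With `R` the unique positive real satisfying `R²√(1+R²) = 1` and
`λ = 1 + 1/(2√(1+R²))`: `Φ_{f+}(ξ,η) = 0` and `∇_η Φ_{f+}(ξ,η) = 0` hold
simultaneously iff `ξ = λ·η` and `|η| = R`. -/
theorem spacetime_resonant_set_fplus (R lam : ℝ) (hR : 0 < R)
    (hReq : R ^ 2 * Real.sqrt (1 + R ^ 2) = 1)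
    (hlam : lam = 1 + 1 / (2 * Real.sqrt (1 + R ^ 2)))
    (ξ η : EuclideanSpace ℝ (Fin 3)) :
    (phiFplus ξ η = 0 ∧ gradient (phiFplus ξ) η = 0) ↔ (ξ = lam • η ∧ ‖η‖ = R) := by
  rw [(phiFplus_hasGradientAt ξ η).gradient]
  have hspos : 0 < Real.sqrt (1 + ‖η‖ ^ 2) := by positivity
  have hsq : Real.sqrt (1 + ‖η‖ ^ 2) ^ 2 = 1 + ‖η‖ ^ 2 := Real.sq_sqrt (by positivity)
  have hgrad : (2:ℝ) • (ξ - η) - (1 / Real.sqrt (1 + ‖η‖ ^ 2)) • η = 0 ↔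
      ξ = (1 + 1 / (2 * Real.sqrt (1 + ‖η‖ ^ 2))) • η := by
    have e : (2:ℝ) • (ξ - η) - (1 / Real.sqrt (1 + ‖η‖ ^ 2)) • η =
        (2:ℝ) • (ξ - (1 + 1 / (2 * Real.sqrt (1 + ‖η‖ ^ 2))) • η) := by
      match_scalars <;> field_simp
      ring
    rw [e, smul_eq_zero, sub_eq_zero]
    simp
  have hphi : ξ = (1 + 1 / (2 * Real.sqrt (1 + ‖η‖ ^ 2))) • η →
      (phiFplus ξ η = 0 ↔ ‖η‖ ^ 2 * Real.sqrt (1 + ‖η‖ ^ 2) = 1) := by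
    intro h
    have hd : ξ - η = (1 / (2 * Real.sqrt (1 + ‖η‖ ^ 2))) • η := by
      rw [h, add_smul, one_smul, add_sub_cancel_left]
    unfold phiFplus
    rw [hd, h, norm_smul, norm_smul, mul_pow, mul_pow, Real.norm_eq_abs, Real.norm_eq_abs,
      sq_abs, sq_abs]
    generalize Real.sqrt (1 + ‖η‖ ^ 2) = s at *
    have e : (1 + 1 / (2 * s)) ^ 2 * ‖η‖ ^ 2 - s - (1 / (2 * s)) ^ 2 * ‖η‖ ^ 2
        = (‖η‖ ^ 2 * s - 1) / s := by
      field_simp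
      linear_combination (-4) * s * hsq
    rw [e, div_eq_zero_iff, sub_eq_zero]
    simp [hspos.ne']
  rw [hgrad]
  constructor
  · rintro ⟨h1, h2⟩
    have h3 := (hphi h2).1 h1
    have hn : ‖η‖ = R := by
      rcases lt_trichotomy ‖η‖ R with h | h | h
      · have a : ‖η‖ ^ 2 < R ^ 2 := by gcongr
        have b : Real.sqrt (1 + ‖η‖ ^ 2) ≤ Real.sqrt (1 + R ^ 2) := by gcongr
        nlinarith [sq_nonneg ‖η‖]
      · exact h
      · have a : R ^ 2 < ‖η‖ ^ 2 := by gcongr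
        have b : Real.sqrt (1 + R ^ 2) ≤ Real.sqrt (1 + ‖η‖ ^ 2) := by gcongr
        nlinarith [sq_nonneg R]
    refine ⟨?_, hn⟩
    rw [hlam, ← hn]
    exact h2
  · rintro ⟨h1, h2⟩
    have h3 : ξ = (1 + 1 / (2 * Real.sqrt (1 + ‖η‖ ^ 2))) • η := by
      rw [h2, ← hlam]
      exact h1
    refine ⟨(hphi h3).2 ?_, h3⟩
    rw [h2]
    exact hReq
end
end

section
/- There exists a constant c > 0 (one may take c = 1/2) such that for all ξ, η ∈ ℝ³, either |Φ_{f−}(ξ,η)| ≥ c or |∇_η Φ_{f−}(ξ,η)| ≥ c. That is, the time resonant set and the space resonant set of Φ_{f−} are uniformly separated: the phase and its η-gradient cannot both be small. -/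
noncomputable section

/-- The phase `Φ_{f−}(ξ,η) = |ξ|² + ⟨η⟩ − |ξ−η|²` with `⟨η⟩ = √(1+|η|²)`. -/
def phiFminus (ξ η : EuclideanSpace ℝ (Fin 3)) : ℝ :=
  ‖ξ‖ ^ 2 + Real.sqrt (1 + ‖η‖ ^ 2) - ‖ξ - η‖ ^ 2

/-- The time resonant and space resonant sets of `Φ_{f−}` are uniformly separated:
there is `c > 0` such that at every `(ξ,η)` either `|Φ_{f−}| ≥ c` or `|∇_η Φ_{f−}| ≥ c`. -/
theorem fminus_resonances_uniformly_separated :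
    ∃ c : ℝ, 0 < c ∧ ∀ ξ η : EuclideanSpace ℝ (Fin 3),
      c ≤ |phiFminus ξ η| ∨ c ≤ ‖gradient (phiFminus ξ) η‖ := by
  refine ⟨1 / 2, by norm_num, fun ξ η => ?_⟩
  by_cases hg : 1 / 2 ≤ ‖gradient (phiFminus ξ) η‖
  · exact Or.inr hg
  left
  push Not at hg
  have hpos : 0 < 1 + ‖η‖ ^ 2 := by positivity
  set s := Real.sqrt (1 + ‖η‖ ^ 2) with hs
  have hs0 : 0 < s := Real.sqrt_pos.mpr hpos
  have hss : s ^ 2 = 1 + ‖η‖ ^ 2 := Real.sq_sqrt hpos.le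
  have h1 : HasFDerivAt (fun x : EuclideanSpace ℝ (Fin 3) => ‖x‖ ^ 2) _ η :=
    (hasStrictFDerivAt_norm_sq η).hasFDerivAt
  have h2 := (h1.const_add 1).sqrt hpos.ne'
  have h3 : HasFDerivAt (fun x : EuclideanSpace ℝ (Fin 3) => ‖ξ - x‖ ^ 2) _ η :=
    ((hasFDerivAt_id η).const_sub ξ).norm_sq
  have h4 : HasFDerivAt (phiFminus ξ) _ η := (h2.const_add (‖ξ‖ ^ 2)).sub h3
  have key : inner ℝ (gradient (phiFminus ξ) η) η
      = ‖η‖ ^ 2 / s + 2 * inner ℝ ξ η - 2 * ‖η‖ ^ 2 := by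
    rw [gradient, InnerProductSpace.toDual_symm_apply, h4.fderiv]
    simp [inner_sub_left, ← hs]
    field_simp
    ring
  have hphi : phiFminus ξ η = 2 * inner ℝ ξ η - ‖η‖ ^ 2 + s := by
    rw [phiFminus, norm_sub_sq_real, ← hs]
    ring
  have hcs := abs_le.mp (abs_real_inner_le_norm (gradient (phiFminus ξ) η) η)
  have hr := norm_nonneg η
  have hmul : ‖gradient (phiFminus ξ) η‖ * ‖η‖ ≤ 1 / 2 * ‖η‖ :=
    mul_le_mul_of_nonneg_right hg.le hr
  have hdiv : s - ‖η‖ ^ 2 / s = 1 / s := by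
    field_simp
    linarith
  have hinv : 1 - ‖η‖ ^ 2 / 2 ≤ 1 / s := by
    rw [le_div_iff₀ hs0]
    have : ‖η‖ ^ 2 = s ^ 2 - 1 := by linarith
    rw [this]
    nlinarith [mul_nonneg (sq_nonneg (s - 1)) (by linarith : (0:ℝ) ≤ s + 2)]
  refine le_trans ?_ (le_abs_self _)
  rw [hphi]
  nlinarith [sq_nonneg (‖η‖ - 1 / 2)]
end
end

section
/- Let 𝒯 = {(ξ,η) ∈ ℝ³×ℝ³ : Φ_{f+}(ξ,η) = 0}, 𝒮 = {(ξ,η) : ∇_η Φ_{f+}(ξ,η) = 0}, and ℛ = 𝒯 ∩ 𝒮. There exist δ₀ > 0 and c > 0 such that for every (ξ,η) with dist((ξ,η), ℛ) ≤ 2δ₀, one has dist((ξ,η), 𝒯) + dist((ξ,η), 𝒮) ≥ c · dist((ξ,η), ℛ) (the time resonant and space resonant sets intersect transversally along the space-time resonant set). -/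
noncomputable section

/-- The time resonant set `𝒯 = {Φ_{f+} = 0}`. -/
def timeResonantSet : Set (EuclideanSpace ℝ (Fin 3) × EuclideanSpace ℝ (Fin 3)) :=
  {p | phiFplus p.1 p.2 = 0}

/-- The space resonant set `𝒮 = {∇_η Φ_{f+} = 0}`. -/
def spaceResonantSet : Set (EuclideanSpace ℝ (Fin 3) × EuclideanSpace ℝ (Fin 3)) :=
  {p | gradient (phiFplus p.1) p.2 = 0}



lemma phi_hasGradient (ξ η : (EuclideanSpace ℝ (Fin 3))) :
    HasGradientAt (phiFplus ξ)
      ((2:ℝ) • (ξ - η) - (Real.sqrt (1 + ‖η‖ ^ 2))⁻¹ • η) η := by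
  have hpos : (0:ℝ) < 1 + ‖η‖ ^ 2 := by positivity
  have h1 : HasFDerivAt (fun x : (EuclideanSpace ℝ (Fin 3)) => 1 + ‖x‖ ^ 2) (2 • (innerSL ℝ η)) η := by
    simpa using ((hasStrictFDerivAt_norm_sq η).hasFDerivAt).const_add (1:ℝ)
  have h2 := h1.sqrt hpos.ne'
  have h3 : HasFDerivAt (fun x : (EuclideanSpace ℝ (Fin 3)) => ‖ξ - x‖ ^ 2) (2 • (innerSL ℝ (ξ - η)).comp
      (-ContinuousLinearMap.id ℝ (EuclideanSpace ℝ (Fin 3)))) η :=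
    ((hasFDerivAt_id η).const_sub ξ).norm_sq
  have h4 := (h2.const_sub (‖ξ‖ ^ 2)).sub h3
  rw [hasGradientAt_iff_hasFDerivAt]
  refine h4.congr_fderiv ?_
  ext v
  have hs : Real.sqrt (1 + ‖η‖ ^ 2) ≠ 0 := (Real.sqrt_pos.2 hpos).ne'
  simp [inner_sub_left, inner_smul_left]
  field_simp
  ring

lemma mem_S_iff (ξ η : (EuclideanSpace ℝ (Fin 3))) :
    (ξ, η) ∈ spaceResonantSet ↔
      ξ = (1 + (Real.sqrt (1 + ‖η‖ ^ 2))⁻¹ / 2) • η := by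
  unfold spaceResonantSet
  simp only [Set.mem_setOf_eq]
  rw [(phi_hasGradient ξ η).gradient]
  set a := (Real.sqrt (1 + ‖η‖ ^ 2))⁻¹
  constructor
  · intro h
    have : ξ - (1 + a / 2) • η = (1/2 : ℝ) • ((2:ℝ) • (ξ - η) - a • η) := by module
    rw [h, smul_zero] at this
    exact sub_eq_zero.1 this
  · intro h
    rw [h]; module

lemma isClosed_T : IsClosed timeResonantSet := by
  unfold timeResonantSet phiFplus
  exact isClosed_eq (by fun_prop) continuous_const

lemma isClosed_S : IsClosed spaceResonantSet := by
  have : spaceResonantSet = {p : (EuclideanSpace ℝ (Fin 3)) × (EuclideanSpace ℝ (Fin 3)) | p.1 = (1 + (Real.sqrt (1 + ‖p.2‖ ^ 2))⁻¹ / 2) • p.2} := by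
    ext ⟨x, y⟩; exact mem_S_iff x y
  rw [this]
  refine isClosed_eq (by fun_prop) ?_
  have : Continuous fun p : (EuclideanSpace ℝ (Fin 3)) × (EuclideanSpace ℝ (Fin 3)) => (Real.sqrt (1 + ‖p.2‖ ^ 2))⁻¹ :=
    Continuous.inv₀ (by fun_prop) (fun p => (Real.sqrt_pos.2 (by positivity)).ne')
  fun_prop

lemma phi_eq (ξ η : (EuclideanSpace ℝ (Fin 3))) :
    phiFplus ξ η = 2 * inner ℝ ξ η - ‖η‖ ^ 2 - Real.sqrt (1 + ‖η‖ ^ 2) := by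
  unfold phiFplus
  rw [norm_sub_sq_real]; ring

lemma phi_on_S (η : (EuclideanSpace ℝ (Fin 3))) (s : ℝ) (hs : s = Real.sqrt (1 + ‖η‖ ^ 2)) :
    phiFplus ((1 + s⁻¹ / 2) • η) η = s ^ 2 - 1 - s⁻¹ := by
  have hpos : 0 < s := hs ▸ Real.sqrt_pos.2 (by positivity)
  have h2 : s ^ 2 = 1 + ‖η‖ ^ 2 := by rw [hs, Real.sq_sqrt (by positivity)]
  have h3 : ‖η‖ ^ 2 = s ^ 2 - 1 := by linarith
  rw [phi_eq, ← hs, inner_smul_left, real_inner_self_eq_norm_sq, h3]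
  simp
  field_simp
  ring

lemma exists_s0 : ∃ s : ℝ, 1.3 ≤ s ∧ s ≤ 1.4 ∧ s ^ 2 - 1 - s⁻¹ = 0 := by
  have hc : ContinuousOn (fun s : ℝ => s ^ 3 - s - 1) (Set.Icc 1.3 1.4) := by fun_prop
  have := intermediate_value_Icc (by norm_num) hc
  obtain ⟨s, ⟨h1, h2⟩, h3⟩ := this (show (0:ℝ) ∈ Set.Icc _ _ by constructor <;> norm_num)
  refine ⟨s, h1, h2, ?_⟩
  have : s ≠ 0 := by linarith
  field_simp
  simp only at h3
  linarith

lemma mem_R (s r : ℝ) (h1 : 1 ≤ s) (h : s ^ 2 - 1 - s⁻¹ = 0) (hr : r ^ 2 = s ^ 2 - 1)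
    (η : (EuclideanSpace ℝ (Fin 3))) (hη : ‖η‖ = r) :
    ((1 + s⁻¹ / 2) • η, η) ∈ timeResonantSet ∩ spaceResonantSet := by
  have hs : s = Real.sqrt (1 + ‖η‖ ^ 2) := by
    rw [hη, hr, show 1 + (s ^ 2 - 1) = s ^ 2 by ring, Real.sqrt_sq (by linarith)]
  refine ⟨?_, ?_⟩
  · change phiFplus _ _ = 0
    rw [phi_on_S η s hs, h]
  · rw [mem_S_iff, ← hs]

lemma g_lower (s t : ℝ) (hs : 1 ≤ s) (ht : 1 ≤ t) (h : t ^ 2 - 1 - t⁻¹ = 0) :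
    |s - t| ≤ |s ^ 2 - 1 - s⁻¹| := by
  have : s ^ 2 - 1 - s⁻¹ = (s - t) * (s + t + (s * t)⁻¹) := by
    have h0 : s ^ 2 - 1 - s⁻¹ = (s ^ 2 - 1 - s⁻¹) - (t ^ 2 - 1 - t⁻¹) := by rw [h]; ring
    rw [h0]
    have : s ≠ 0 := by linarith
    have : t ≠ 0 := by linarith
    field_simp
    ring
  rw [this, abs_mul]
  have h2 : 0 ≤ (s * t)⁻¹ := by positivity
  rw [abs_of_nonneg (a := s + t + _) (by linarith)]
  nlinarith [abs_nonneg (s - t)]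

/-- every space resonance parameter is on the unique sphere -/
lemma R_bdd (p : (EuclideanSpace ℝ (Fin 3)) × (EuclideanSpace ℝ (Fin 3))) (hp : p ∈ timeResonantSet ∩ spaceResonantSet) : ‖p‖ ≤ 2 := by
  obtain ⟨s0, ha, hb, h0⟩ := exists_s0
  obtain ⟨ξ, η⟩ := p
  obtain ⟨hT, hS⟩ := hp
  rw [mem_S_iff] at hS
  set s := Real.sqrt (1 + ‖η‖ ^ 2) with hs
  have h1 : 1 ≤ s := Real.one_le_sqrt.2 (by nlinarith [sq_nonneg ‖η‖])
  have h2 : s ^ 2 = 1 + ‖η‖ ^ 2 := by rw [hs, Real.sq_sqrt (by positivity)]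
  change phiFplus ξ η = 0 at hT
  rw [hS, phi_on_S η s hs] at hT
  have h3 := g_lower s s0 h1 (by linarith) h0
  rw [hT, abs_zero] at h3
  have h4 : s = s0 := sub_eq_zero.1 (abs_nonpos_iff.1 h3)
  have h5 : ‖η‖ ≤ 1 := by
    rw [h4] at h2; nlinarith [norm_nonneg η]
  have h6 : s⁻¹ ≤ 1 := inv_le_one_of_one_le₀ h1
  have h7 : 0 ≤ s⁻¹ := by positivity
  rw [Prod.norm_mk]
  refine max_le ?_ (by linarith)
  rw [hS, norm_smul, Real.norm_eq_abs, abs_of_nonneg (by positivity)]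
  nlinarith [norm_nonneg η]

lemma phi_lip (p q : (EuclideanSpace ℝ (Fin 3)) × (EuclideanSpace ℝ (Fin 3))) (hp : ‖p‖ ≤ 5) (hq : ‖q‖ ≤ 5) :
    |phiFplus p.1 p.2 - phiFplus q.1 q.2| ≤ 31 * dist p q := by
  obtain ⟨x, y⟩ := p
  obtain ⟨x', y'⟩ := q
  have hx : ‖x‖ ≤ 5 := (norm_fst_le (x, y)).trans hp
  have hy : ‖y‖ ≤ 5 := (norm_snd_le (x, y)).trans hp
  have hx' : ‖x'‖ ≤ 5 := (norm_fst_le (x', y')).trans hq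
  have hy' : ‖y'‖ ≤ 5 := (norm_snd_le (x', y')).trans hq
  set D := dist (x, y) (x', y') with hD
  have hDx : ‖x - x'‖ ≤ D := by rw [hD, Prod.dist_eq, ← dist_eq_norm]; exact le_max_left _ _
  have hDy : ‖y - y'‖ ≤ D := by rw [hD, Prod.dist_eq, ← dist_eq_norm]; exact le_max_right _ _
  have hD0 : 0 ≤ D := dist_nonneg
  simp only [phi_eq]
  have e1 : |(inner ℝ x y : ℝ) - inner ℝ x' y'| ≤ 10 * D := by
    have : (inner ℝ x y : ℝ) - inner ℝ x' y' = inner ℝ (x - x') y + inner ℝ x' (y - y') := by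
      simp [inner_sub_left, inner_sub_right]
    rw [this]
    have a1 := abs_real_inner_le_norm (x - x') y
    have a2 := abs_real_inner_le_norm x' (y - y')
    have a3 : ‖x - x'‖ * ‖y‖ ≤ D * 5 := by gcongr
    have a4 : ‖x'‖ * ‖y - y'‖ ≤ 5 * D := by gcongr
    have := abs_add_le (inner ℝ (x - x') y : ℝ) (inner ℝ x' (y - y'))
    linarith
  have e0 : |‖y‖ - ‖y'‖| ≤ D := (abs_norm_sub_norm_le y y').trans hDy
  have e2 : |‖y‖ ^ 2 - ‖y'‖ ^ 2| ≤ 10 * D := by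
    rw [sq_sub_sq, abs_mul, abs_of_nonneg (by positivity)]
    have : ‖y‖ + ‖y'‖ ≤ 10 := by linarith
    gcongr
  have e3 : |Real.sqrt (1 + ‖y‖ ^ 2) - Real.sqrt (1 + ‖y'‖ ^ 2)| ≤ D := by
    set a := Real.sqrt (1 + ‖y‖ ^ 2) with ha
    set b := Real.sqrt (1 + ‖y'‖ ^ 2) with hb
    have ha2 : a ^ 2 = 1 + ‖y‖ ^ 2 := Real.sq_sqrt (by positivity)
    have hb2 : b ^ 2 = 1 + ‖y'‖ ^ 2 := Real.sq_sqrt (by positivity)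
    have ha3 : ‖y‖ ≤ a := Real.le_sqrt_of_sq_le (by linarith)
    have hb3 : ‖y'‖ ≤ b := Real.le_sqrt_of_sq_le (by linarith)
    have ha0 : 0 < a := Real.sqrt_pos.2 (by positivity)
    have hb0 : 0 < b := Real.sqrt_pos.2 (by positivity)
    have k : |a - b| * (a + b) = |‖y‖ - ‖y'‖| * (‖y‖ + ‖y'‖) := by
      rw [← abs_of_pos (add_pos ha0 hb0), ← abs_mul,
        ← abs_of_nonneg (add_nonneg (norm_nonneg y) (norm_nonneg y')), ← abs_mul]
      congr 1
      linear_combination ha2 - hb2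
    have k2 : |‖y‖ - ‖y'‖| * (‖y‖ + ‖y'‖) ≤ D * (a + b) := by gcongr
    exact le_of_mul_le_mul_right (k ▸ k2) (add_pos ha0 hb0)
  rw [abs_le] at *
  constructor <;> linarith [e1.1, e1.2, e2.1, e2.2, e3.1, e3.2]

lemma exists_scaled (η : (EuclideanSpace ℝ (Fin 3))) (r : ℝ) (hr : 0 ≤ r) :
    ∃ η' : (EuclideanSpace ℝ (Fin 3)), ‖η'‖ = r ∧ ‖η - η'‖ = |‖η‖ - r| := by
  by_cases h : η = 0
  · refine ⟨EuclideanSpace.single 0 r, ?_, ?_⟩ <;> simp [h, abs_of_nonneg hr]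
  · have hn : ‖η‖ ≠ 0 := norm_ne_zero_iff.2 h
    refine ⟨(r / ‖η‖) • η, ?_, ?_⟩
    · rw [norm_smul, Real.norm_eq_abs, abs_of_nonneg (by positivity)]
      field_simp
    · have : η - (r / ‖η‖) • η = ((‖η‖ - r) / ‖η‖) • η := by
        rw [sub_div, div_self hn]; module
      rw [this, norm_smul, Real.norm_eq_abs, abs_div, abs_norm]
      field_simp

lemma dist_R (q : (EuclideanSpace ℝ (Fin 3)) × (EuclideanSpace ℝ (Fin 3))) (hq : q ∈ spaceResonantSet) (hb : ‖q‖ ≤ 5) :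
    Metric.infDist q (timeResonantSet ∩ spaceResonantSet) ≤ 30 * |phiFplus q.1 q.2| := by
  obtain ⟨s0, h13, h14, h0⟩ := exists_s0
  obtain ⟨ξ, η⟩ := q
  have hη : ‖η‖ ≤ 5 := (norm_snd_le (ξ, η)).trans hb
  rw [mem_S_iff] at hq
  set s := Real.sqrt (1 + ‖η‖ ^ 2) with hs
  have h1 : 1 ≤ s := Real.one_le_sqrt.2 (by nlinarith [sq_nonneg ‖η‖])
  have h2 : s ^ 2 = 1 + ‖η‖ ^ 2 := by rw [hs, Real.sq_sqrt (by positivity)]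
  have h6 : s ≤ 6 := by nlinarith [norm_nonneg η]
  subst hq
  simp only
  rw [phi_on_S η s hs]
  have h3 := g_lower s s0 h1 (by linarith) h0
  obtain ⟨r, hr0, hr2⟩ : ∃ r : ℝ, 0 ≤ r ∧ r ^ 2 = s0 ^ 2 - 1 :=
    ⟨Real.sqrt (s0 ^ 2 - 1), Real.sqrt_nonneg _, Real.sq_sqrt (by nlinarith)⟩
  have hr5 : 1 / 2 ≤ r := by nlinarith
  obtain ⟨η', hn, hd⟩ := exists_scaled η r hr0
  have hR := mem_R s0 r (by linarith) h0 hr2 η' hn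
  have key : |‖η‖ - r| ≤ 15 * |s - s0| := by
    have k : |‖η‖ - r| * (‖η‖ + r) = |s - s0| * (s + s0) := by
      have k0 : (‖η‖ - r) * (‖η‖ + r) = (s - s0) * (s + s0) := by nlinarith
      have := congrArg abs k0
      rwa [abs_mul, abs_mul, abs_of_nonneg (a := ‖η‖ + r) (by positivity),
        abs_of_nonneg (a := s + s0) (by linarith)] at this
    have k1 : |‖η‖ - r| * (1/2) ≤ |‖η‖ - r| * (‖η‖ + r) := by
      gcongr; linarith [norm_nonneg η]
    have k2 : |s - s0| * (s + s0) ≤ |s - s0| * 7.5 := by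
      gcongr; linarith
    linarith
  have hinv : |s⁻¹ - s0⁻¹| ≤ |s - s0| := by
    have e : s⁻¹ - s0⁻¹ = (s0 - s) / (s * s0) := by
      have : s ≠ 0 := by linarith
      have : s0 ≠ 0 := by linarith
      field_simp
    rw [e, abs_div, abs_sub_comm s0 s, abs_of_nonneg (a := s * s0) (by nlinarith)]
    exact div_le_self (abs_nonneg _) (by nlinarith)
  refine (Metric.infDist_le_dist_of_mem hR).trans ?_
  have hA := abs_nonneg (s - s0)
  rw [Prod.dist_eq]
  refine max_le ?_ ?_
  · simp only
    rw [dist_eq_norm]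
    have e : (1 + s⁻¹ / 2) • η - (1 + s0⁻¹ / 2) • η' =
      (1 + s0⁻¹ / 2) • (η - η') + ((s⁻¹ - s0⁻¹) / 2) • η := by module
    have i1 : s0⁻¹ ≤ 1 := inv_le_one_of_one_le₀ (by linarith)
    have i2 : 0 ≤ s0⁻¹ := inv_nonneg.2 (by linarith)
    have n1 : ‖(1 + s0⁻¹ / 2) • (η - η')‖ ≤ 1.5 * (15 * |s - s0|) := by
      rw [norm_smul, Real.norm_eq_abs, abs_of_nonneg (by positivity), hd]
      gcongr
      linarith
    have n2 : ‖((s⁻¹ - s0⁻¹) / 2) • η‖ ≤ |s - s0| / 2 * 5 := by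
      rw [norm_smul, Real.norm_eq_abs, abs_div, abs_two]
      gcongr
    rw [e]
    have := norm_add_le ((1 + s0⁻¹ / 2) • (η - η')) (((s⁻¹ - s0⁻¹) / 2) • η)
    linarith
  · simp only
    rw [dist_eq_norm, hd]
    linarith

/-- Transversality near the space-time resonant set `ℛ = 𝒯 ∩ 𝒮`:
`dist(·,𝒯) + dist(·,𝒮) ≳ dist(·,ℛ)` in a neighborhood of `ℛ`. -/
theorem transversality_near_spacetime_resonances :
    ∃ δ₀ c : ℝ, 0 < δ₀ ∧ 0 < c ∧
      ∀ p : EuclideanSpace ℝ (Fin 3) × EuclideanSpace ℝ (Fin 3),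
        Metric.infDist p (timeResonantSet ∩ spaceResonantSet) ≤ 2 * δ₀ →
          c * Metric.infDist p (timeResonantSet ∩ spaceResonantSet) ≤
            Metric.infDist p timeResonantSet + Metric.infDist p spaceResonantSet := by
  obtain ⟨s0, h13, h14, h0⟩ := exists_s0
  obtain ⟨r, hr0, hr2⟩ : ∃ r : ℝ, 0 ≤ r ∧ r ^ 2 = s0 ^ 2 - 1 :=
    ⟨Real.sqrt (s0 ^ 2 - 1), Real.sqrt_nonneg _, Real.sq_sqrt (by nlinarith)⟩
  obtain ⟨η0, hn, -⟩ := exists_scaled 0 r hr0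
  have hRne : (timeResonantSet ∩ spaceResonantSet).Nonempty :=
    ⟨_, mem_R s0 r (by linarith) h0 hr2 η0 hn⟩
  refine ⟨1 / 2, 1 / 1000, by norm_num, by norm_num, fun p hp => ?_⟩
  have hTle := Metric.infDist_le_infDist_of_subset (x := p) Set.inter_subset_left hRne
  have hSle := Metric.infDist_le_infDist_of_subset (x := p) Set.inter_subset_right hRne
  obtain ⟨z, hz, hzd⟩ := (isClosed_T.inter isClosed_S).exists_infDist_eq_dist hRne p
  obtain ⟨t, ht, htd⟩ := isClosed_T.exists_infDist_eq_dist (hRne.mono Set.inter_subset_left) p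
  obtain ⟨q, hq, hqd⟩ := isClosed_S.exists_infDist_eq_dist (hRne.mono Set.inter_subset_right) p
  have hzb := R_bdd z hz
  have hpb : ‖p‖ ≤ 3 := by
    have := norm_le_norm_add_norm_sub' p z
    rw [← dist_eq_norm] at this
    linarith
  have htb : ‖t‖ ≤ 5 := by
    have := norm_le_norm_add_norm_sub' t p
    rw [← dist_eq_norm, dist_comm] at this
    linarith
  have hqb : ‖q‖ ≤ 5 := by
    have := norm_le_norm_add_norm_sub' q p
    rw [← dist_eq_norm, dist_comm] at this
    linarith
  have h1 := dist_R q hq hqb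
  have h2 := phi_lip q t hqb htb
  have h3 : phiFplus t.1 t.2 = 0 := ht
  rw [h3, sub_zero] at h2
  have h4 := dist_triangle q p t
  rw [dist_comm q p] at h4
  have h5 := Metric.infDist_le_infDist_add_dist (s := timeResonantSet ∩ spaceResonantSet)
    (x := p) (y := q)
  have d1 : 0 ≤ dist p q := dist_nonneg
  have d2 : 0 ≤ dist p t := dist_nonneg
  rw [htd, hqd]
  linarith
end
end

section
/- Let 𝒯 = {(ξ,η) ∈ ℝ³×ℝ³ : Φ_{f+}(ξ,η) = 0}, 𝒮 = {(ξ,η) : ∇_η Φ_{f+}(ξ,η) = 0}, and ℛ = 𝒯 ∩ 𝒮. There exist δ₀ > 0 and c > 0 such that for every (ξ,η) with dist((ξ,η), ℛ) ≤ 2δ₀, one has |Φ_{f+}(ξ,η)| ≥ c · dist((ξ,η), 𝒯). -/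
noncomputable section

/-- The gradient of the phase in the second variable. -/
theorem hasGradientAt_phiFplus (ξ η : EuclideanSpace ℝ (Fin 3)) :
    HasGradientAt (phiFplus ξ)
      ((-(1 / Real.sqrt (1 + ‖η‖ ^ 2))) • η + (2 : ℝ) • (ξ - η)) η := by
  have hpos : (0 : ℝ) < 1 + ‖η‖ ^ 2 := by positivity
  rw [hasGradientAt_iff_hasFDerivAt]
  have h1 : HasFDerivAt (fun y : EuclideanSpace ℝ (Fin 3) => ‖y‖ ^ 2)
      (2 • innerSL ℝ η) η := (hasStrictFDerivAt_norm_sq η).hasFDerivAt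
  have h2 := (h1.const_add 1).sqrt hpos.ne'
  have h3 : HasFDerivAt (fun y : EuclideanSpace ℝ (Fin 3) => ‖ξ - y‖ ^ 2)
      ((2 • innerSL ℝ (ξ - η)).comp (-ContinuousLinearMap.id ℝ _)) η :=
    HasFDerivAt.comp η (hasStrictFDerivAt_norm_sq (ξ - η)).hasFDerivAt
      ((hasFDerivAt_id η).const_sub ξ)
  have h4 := (h2.const_sub (‖ξ‖ ^ 2)).sub h3
  refine h4.congr_fderiv ?_
  ext v
  have hs : Real.sqrt (1 + ‖η‖ ^ 2) ≠ 0 := (Real.sqrt_pos.2 hpos).ne'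
  simp [inner_add_left, inner_smul_left, inner_sub_left]
  field_simp
  try ring

/-- The phase is affine in the first variable. -/
theorem phiFplus_eq (ξ η : EuclideanSpace ℝ (Fin 3)) :
    phiFplus ξ η = 2 * inner ℝ ξ η - ‖η‖ ^ 2 - Real.sqrt (1 + ‖η‖ ^ 2) := by
  unfold phiFplus
  rw [norm_sub_sq_real]
  ring

theorem resonant_lower_bound (p : EuclideanSpace ℝ (Fin 3) × EuclideanSpace ℝ (Fin 3))
    (hp : p ∈ timeResonantSet ∩ spaceResonantSet) : 1 / 2 ≤ ‖p.2‖ := by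
  obtain ⟨ξ, η⟩ := p
  obtain ⟨hT, hS⟩ := hp
  have hT' : phiFplus ξ η = 0 := hT
  have hS' : gradient (phiFplus ξ) η = 0 := hS
  rw [(hasGradientAt_phiFplus ξ η).gradient] at hS'
  rw [phiFplus_eq] at hT'
  have hi := congrArg (fun v => inner ℝ v η) hS'
  simp only [inner_add_left, inner_smul_left, inner_sub_left, real_inner_self_eq_norm_sq,
    inner_zero_left] at hi
  simp only [conj_trivial] at hi
  have hpos : (0 : ℝ) < 1 + ‖η‖ ^ 2 := by positivity
  have hs := Real.sqrt_pos.2 hpos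
  have hsq := Real.sq_sqrt hpos.le
  show 1 / 2 ≤ ‖η‖
  set s := Real.sqrt (1 + ‖η‖ ^ 2)
  have hn := norm_nonneg η
  generalize ‖η‖ = r at *
  generalize inner ℝ ξ η = a at *
  have h5 : s * r ^ 2 + r ^ 2 - s ^ 2 = 0 := by
    field_simp at hi
    nlinarith
  by_contra hlt
  push Not at hlt
  have hr : r ^ 2 < 1 / 4 := by nlinarith
  nlinarith

theorem resonant_nonempty : (timeResonantSet ∩ spaceResonantSet).Nonempty := by
  have hivt : (0 : ℝ) ∈ (fun s : ℝ => s ^ 3 - s - 1) '' Set.Icc 1 2 :=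
    intermediate_value_Icc (by norm_num) (by fun_prop) (by norm_num)
  obtain ⟨s, ⟨h1, h2⟩, hs⟩ := hivt
  have hs' : s ^ 3 - s - 1 = 0 := hs
  obtain ⟨η, hη⟩ := exists_norm_eq (EuclideanSpace ℝ (Fin 3)) (Real.sqrt_nonneg (s ^ 2 - 1))
  have hη2 : ‖η‖ ^ 2 = s ^ 2 - 1 := by
    rw [hη, Real.sq_sqrt]; nlinarith
  have hsq : Real.sqrt (1 + ‖η‖ ^ 2) = s := by
    rw [hη2, add_sub_cancel, Real.sqrt_sq (by linarith)]
  have hs0 : s ≠ 0 := by positivity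
  refine ⟨((1 + 1 / (2 * s)) • η, η), ?_, ?_⟩
  · show phiFplus _ _ = 0
    rw [phiFplus_eq, hsq, inner_smul_left, real_inner_self_eq_norm_sq, hη2]
    simp only [conj_trivial]
    field_simp
    linear_combination hs'
  · show gradient _ _ = 0
    rw [(hasGradientAt_phiFplus _ η).gradient, hsq]
    match_scalars
    field_simp
    ring

/-- Near the space-time resonant set `ℛ = 𝒯 ∩ 𝒮`, the phase dominates the
distance to the time resonant set: `|Φ_{f+}(ξ,η)| ≥ c · dist((ξ,η), 𝒯)`. -/
theorem phase_controls_distance_to_time_resonances :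
    ∃ δ₀ c : ℝ, 0 < δ₀ ∧ 0 < c ∧
      ∀ p : EuclideanSpace ℝ (Fin 3) × EuclideanSpace ℝ (Fin 3),
        Metric.infDist p (timeResonantSet ∩ spaceResonantSet) ≤ 2 * δ₀ →
          c * Metric.infDist p timeResonantSet ≤ |phiFplus p.1 p.2| := by
  refine ⟨1 / 8, 1 / 4, by norm_num, by norm_num, ?_⟩
  rintro ⟨ξ, η⟩ hp
  obtain ⟨q, hq, hd⟩ := (Metric.infDist_lt_iff (r := 3 / 8) resonant_nonempty).1
    (lt_of_le_of_lt hp (by norm_num))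
  have hq2 := resonant_lower_bound q hq
  have hd2 : dist η q.2 < 3 / 8 := lt_of_le_of_lt (le_max_right _ _) hd
  have hη : 1 / 8 ≤ ‖η‖ := by
    have := norm_sub_norm_le q.2 η
    rw [dist_comm, dist_eq_norm] at hd2
    linarith
  have hη0 : 0 < ‖η‖ := by linarith
  set t : ℝ := -phiFplus ξ η / (2 * ‖η‖ ^ 2) with ht
  have hmem : (ξ + t • η, η) ∈ timeResonantSet := by
    show phiFplus _ _ = 0
    have h1 : phiFplus (ξ + t • η) η = phiFplus ξ η + 2 * t * ‖η‖ ^ 2 := by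
      rw [phiFplus_eq, phiFplus_eq, inner_add_left, inner_smul_left, real_inner_self_eq_norm_sq]
      simp only [conj_trivial]
      ring
    rw [h1, ht]
    field_simp
    ring
  have hle := Metric.infDist_le_dist_of_mem (x := (ξ, η)) hmem
  have hdist : dist (ξ, η) (ξ + t • η, η) = |phiFplus ξ η| / (2 * ‖η‖) := by
    rw [Prod.dist_eq]
    simp only [dist_self, dist_self_add_right, norm_smul, Real.norm_eq_abs]
    rw [max_eq_left (by positivity), ht, abs_div, abs_neg,
      abs_of_pos (show 0 < 2 * ‖η‖ ^ 2 by positivity)]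
    field_simp
  rw [hdist, le_div_iff₀ (by positivity)] at hle
  have hnn : 0 ≤ Metric.infDist (ξ, η) timeResonantSet := Metric.infDist_nonneg
  show 1 / 4 * Metric.infDist (ξ, η) timeResonantSet ≤ |phiFplus ξ η|
  nlinarith
end
end
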